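/- Fix s∈ℝ, q≥0 and β∈ℝ. There exist constants 0<K₁≤K₂ (depending on s, q, β) such that for all finite words 𝔦,𝔧∈𝓘* and all a∈[0,1]², the q-modified singular value function satisfies K₁·ψ^{s,q}_a(𝔦)·ψ^{s,q}_a(𝔧) ≤ ψ^{s,q}_a(𝔦𝔧) ≤ K₂·ψ^{s,q}_a(𝔦)·ψ^{s,q}_a(𝔧), where 𝔦𝔧 denotes concatenation of words. -/

import Mathlib

/-!
Setting (Falconer–Fraser–Lee, "L^q-spectra of measures on planar non-conformal attractors"):
a finite family of C^{1+α} skew-product contractions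
`S i (x,y) = (f i x, g i (x,y))` of the unit square, satisfying a domination
condition on the (lower triangular) Jacobians.
-/

open Set Filter Topology MeasureTheory
open scoped Classical ENNReal

noncomputable section

/-- The closed unit square `[0,1]² ⊆ ℝ²`. -/
def unitSq : Set (ℝ × ℝ) := Set.Icc (0:ℝ) 1 ×ˢ Set.Icc (0:ℝ) 1

variable {ι : Type*} [Fintype ι]

/-- The skew-product map `S_i(x,y) = (f_i x, g_i (x,y))`. -/
def Smap (f : ι → ℝ → ℝ) (g : ι → ℝ × ℝ → ℝ) (i : ι) : ℝ × ℝ → ℝ × ℝ :=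
  fun a => (f i a.1, g i a)

/-- The composition `S_𝔦 = S_{i₁} ∘ ⋯ ∘ S_{i_k}` along a finite word `𝔦 = [i₁, …, i_k]`. -/
def Sword (f : ι → ℝ → ℝ) (g : ι → ℝ × ℝ → ℝ) : List ι → ℝ × ℝ → ℝ × ℝ
  | [] => id
  | i :: l => Smap f g i ∘ Sword f g l

/-- The first component `f_𝔦 = f_{i₁} ∘ ⋯ ∘ f_{i_k}` of `S_𝔦` (a function of `x` only). -/
def fword (f : ι → ℝ → ℝ) : List ι → ℝ → ℝ
  | [] => id
  | i :: l => f i ∘ fword f l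

/-- Top-left entry `f_{𝔦,x}(a)` of the (lower triangular) Jacobian `D_a S_𝔦`. -/
def fxw (f : ι → ℝ → ℝ) (g : ι → ℝ × ℝ → ℝ) (l : List ι) (a : ℝ × ℝ) : ℝ :=
  deriv (fun x => (Sword f g l (x, a.2)).1) a.1

/-- Bottom-left entry `g_{𝔦,x}(a)` of the Jacobian `D_a S_𝔦`. -/
def gxw (f : ι → ℝ → ℝ) (g : ι → ℝ × ℝ → ℝ) (l : List ι) (a : ℝ × ℝ) : ℝ :=
  deriv (fun x => (Sword f g l (x, a.2)).2) a.1

/-- Bottom-right entry `g_{𝔦,y}(a)` of the Jacobian `D_a S_𝔦`. -/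
def gyw (f : ι → ℝ → ℝ) (g : ι → ℝ × ℝ → ℝ) (l : List ι) (a : ℝ × ℝ) : ℝ :=
  deriv (fun y => (Sword f g l (a.1, y)).2) a.2

/-- The standing hypotheses: `|𝓘| ≥ 2`; each `S_i(x,y) = (f_i x, g_i(x,y))` maps the unit
square into itself; `f_i, g_i` are `C^{1+α}` contractions (`0 < α ≤ 1`); and the
domination condition `inf f_{i,x} > sup g_{i,y} ≥ inf g_{i,y} ≥ d > 0` holds. -/
structure IFSHyp (f : ι → ℝ → ℝ) (g : ι → ℝ × ℝ → ℝ) (α d : ℝ) : Prop where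
  card2 : 2 ≤ Fintype.card ι
  alpha_pos : 0 < α
  alpha_le_one : α ≤ 1
  d_pos : 0 < d
  maps_f : ∀ i, Set.MapsTo (f i) (Set.Icc 0 1) (Set.Icc 0 1)
  maps_g : ∀ i, Set.MapsTo (g i) unitSq (Set.Icc 0 1)
  diff_f : ∀ i, Differentiable ℝ (f i)
  diff_g : ∀ i, Differentiable ℝ (g i)
  holder_f : ∀ i, ∃ H : ℝ, ∀ x ∈ Set.Icc (0:ℝ) 1, ∀ y ∈ Set.Icc (0:ℝ) 1,
      |deriv (f i) x - deriv (f i) y| ≤ H * |x - y| ^ α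
  holder_g : ∀ i, ∃ H : ℝ, ∀ a ∈ unitSq, ∀ b ∈ unitSq,
      ‖fderiv ℝ (g i) a - fderiv ℝ (g i) b‖ ≤ H * ‖a - b‖ ^ α
  contr_f : ∀ i, ∃ c, 0 ≤ c ∧ c < 1 ∧ ∀ x ∈ Set.Icc (0:ℝ) 1, ∀ y ∈ Set.Icc (0:ℝ) 1,
      |f i x - f i y| ≤ c * |x - y|
  contr_g : ∀ i, ∃ c, 0 ≤ c ∧ c < 1 ∧ ∀ a ∈ unitSq, ∀ b ∈ unitSq,
      |g i a - g i b| ≤ c * ‖a - b‖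
  dom : ∀ i, sSup (gyw f g [i] '' unitSq) < sInf (fxw f g [i] '' unitSq)
  dom_d : ∀ i, ∀ a ∈ unitSq, d ≤ gyw f g [i] a

/-- The larger singular value of the lower triangular matrix `A = [[a,0],[b,c]]`, i.e. the
square root of the larger eigenvalue of `AᵀA`, in explicit closed form. -/
def sv1 (a b c : ℝ) : ℝ :=
  Real.sqrt (((a ^ 2 + b ^ 2 + c ^ 2) +
    Real.sqrt ((a ^ 2 + b ^ 2 + c ^ 2) ^ 2 - 4 * (a * c) ^ 2)) / 2)

/-- The smaller singular value of the lower triangular matrix `A = [[a,0],[b,c]]`, i.e. the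
square root of the smaller eigenvalue of `AᵀA`, in explicit closed form. -/
def sv2 (a b c : ℝ) : ℝ :=
  Real.sqrt (((a ^ 2 + b ^ 2 + c ^ 2) -
    Real.sqrt ((a ^ 2 + b ^ 2 + c ^ 2) ^ 2 - 4 * (a * c) ^ 2)) / 2)

/-- `α₁(D_a S_𝔦)`, the larger singular value of the Jacobian. -/
def alphaOne (f : ι → ℝ → ℝ) (g : ι → ℝ × ℝ → ℝ) (l : List ι) (a : ℝ × ℝ) : ℝ :=
  sv1 (fxw f g l a) (gxw f g l a) (gyw f g l a)

/-- `α₂(D_a S_𝔦)`, the smaller singular value of the Jacobian. -/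
def alphaTwo (f : ι → ℝ → ℝ) (g : ι → ℝ × ℝ → ℝ) (l : List ι) (a : ℝ × ℝ) : ℝ :=
  sv2 (fxw f g l a) (gxw f g l a) (gyw f g l a)

/-- `η = sup_{i, a, b} g_{i,y}(a) / f_{i,x}(b)`. -/
def etaSup (f : ι → ℝ → ℝ) (g : ι → ℝ × ℝ → ℝ) : ℝ :=
  sSup {x : ℝ | ∃ i : ι, ∃ a ∈ unitSq, ∃ b ∈ unitSq, x = gyw f g [i] a / fxw f g [i] b}

/-- `p(𝔦) = p_{i₁} ⋯ p_{i_k}`. -/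
def pword (p : ι → ℝ) (l : List ι) : ℝ := (l.map p).prod

/-- `(p_i)` is a probability vector with all entries in `(0,1)`. -/
def ProbVec (p : ι → ℝ) : Prop := (∀ i, 0 < p i ∧ p i < 1) ∧ ∑ i, p i = 1

/-- The `q`-modified singular value function
`ψ^{s,q}_a(𝔦) = p(𝔦)^q α₁(D_aS_𝔦)^βq α₂(D_aS_𝔦)^(s−βq)` (real exponents). -/
def psiSV (f : ι → ℝ → ℝ) (g : ι → ℝ × ℝ → ℝ) (p : ι → ℝ) (s q βq : ℝ)
    (a : ℝ × ℝ) (l : List ι) : ℝ :=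
  pword p l ^ q * alphaOne f g l a ^ βq * alphaTwo f g l a ^ (s - βq)

/-- `Ψ^{s,q}_{a,k} = Σ_{𝔦 ∈ 𝓘^k} ψ^{s,q}_a(𝔦)`. -/
def PsiSum (f : ι → ℝ → ℝ) (g : ι → ℝ × ℝ → ℝ) (p : ι → ℝ) (s q βq : ℝ)
    (a : ℝ × ℝ) (k : ℕ) : ℝ :=
  ∑ w : Fin k → ι, psiSV f g p s q βq a (List.ofFn w)

/-- The `δ`-stopping `𝓘_{a,δ} = {𝔦 : α₂(D_aS_𝔦) < δ ≤ α₂(D_aS_𝔦̂)}`, where `𝔦̂` drops the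
last letter of `𝔦`. -/
def stopping (f : ι → ℝ → ℝ) (g : ι → ℝ × ℝ → ℝ) (a : ℝ × ℝ) (δ : ℝ) : Set (List ι) :=
  {l | l ≠ [] ∧ alphaTwo f g l a < δ ∧ δ ≤ alphaTwo f g l.dropLast a}

/-- `q`-th power moment sum of a measure on `ℝ` over the `δ`-mesh intervals of positive
measure. -/
def msum1 (ν : Measure ℝ) (q δ : ℝ) : ℝ :=
  ∑' k : ℤ, if 0 < ν (Set.Icc ((k : ℝ) * δ) (((k : ℝ) + 1) * δ)) then
    (ν (Set.Icc ((k : ℝ) * δ) (((k : ℝ) + 1) * δ))).toReal ^ q else 0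

/-- `q`-th power moment sum of a measure on `ℝ²` over the `δ`-mesh squares of positive
measure. -/
def msum2 (ν : Measure (ℝ × ℝ)) (q δ : ℝ) : ℝ :=
  ∑' k : ℤ × ℤ,
    if 0 < ν (Set.Icc ((k.1 : ℝ) * δ) (((k.1 : ℝ) + 1) * δ) ×ˢ
        Set.Icc ((k.2 : ℝ) * δ) (((k.2 : ℝ) + 1) * δ)) then
      (ν (Set.Icc ((k.1 : ℝ) * δ) (((k.1 : ℝ) + 1) * δ) ×ˢ
        Set.Icc ((k.2 : ℝ) * δ) (((k.2 : ℝ) + 1) * δ))).toReal ^ q else 0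

/-- Upper `L^q`-spectrum of a measure on `ℝ²`. -/
def upperTau2 (ν : Measure (ℝ × ℝ)) (q : ℝ) : ℝ :=
  limsup (fun δ => Real.log (msum2 ν q δ) / (-Real.log δ)) (𝓝[>] (0:ℝ))

/-- Lower `L^q`-spectrum of a measure on `ℝ²`. -/
def lowerTau2 (ν : Measure (ℝ × ℝ)) (q : ℝ) : ℝ :=
  liminf (fun δ => Real.log (msum2 ν q δ) / (-Real.log δ)) (𝓝[>] (0:ℝ))

/-- Two positive reals agree up to the factor `K`. -/
def ComparableWith (K x y : ℝ) : Prop := 0 < x ∧ 0 < y ∧ x ≤ K * y ∧ y ≤ K * x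

namespace ComparableWith

variable {K L x y z x' y' : ℝ}

lemma symm (h : ComparableWith K x y) : ComparableWith K y x := ⟨h.2.1, h.1, h.2.2.2, h.2.2.1⟩

lemma one_le (h : ComparableWith K x y) : 1 ≤ K := by
  obtain ⟨hx, hy, h1, h2⟩ := h
  by_contra! hK
  nlinarith

lemma trans (h : ComparableWith K x y) (h' : ComparableWith L y z) :
    ComparableWith (K * L) x z := by
  have hK := h.one_le
  have hL := h'.one_le
  obtain ⟨hx, hy, h1, h2⟩ := h
  obtain ⟨-, hz, h3, h4⟩ := h'
  refine ⟨hx, hz, ?_, ?_⟩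
  · calc x ≤ K * y := h1
      _ ≤ K * (L * z) := by gcongr
      _ = K * L * z := by ring
  · calc z ≤ L * y := h4
      _ ≤ L * (K * x) := by gcongr
      _ = K * L * x := by ring

lemma mul (h : ComparableWith K x y) (h' : ComparableWith L x' y') :
    ComparableWith (K * L) (x * x') (y * y') := by
  have hK := h.one_le
  have hL := h'.one_le
  obtain ⟨hx, hy, h1, h2⟩ := h
  obtain ⟨hx', hy', h3, h4⟩ := h'
  refine ⟨by positivity, by positivity, ?_, ?_⟩
  · calc x * x' ≤ (K * y) * (L * y') := by gcongr
      _ = _ := by ring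
  · calc y * y' ≤ (K * x) * (L * x') := by gcongr
      _ = _ := by ring

lemma refl (hx : 0 < x) : ComparableWith 1 x x := ⟨hx, hx, by simp, by simp⟩

lemma rpow_le (h : ComparableWith K x y) (t : ℝ) : x ^ t ≤ K ^ |t| * y ^ t := by
  have hK : 0 < K := one_pos.trans_le h.one_le
  obtain ⟨hx, hy, h1, h2⟩ := h
  rcases le_total 0 t with ht | ht
  · rw [abs_of_nonneg ht, ← Real.mul_rpow hK.le hy.le]
    exact Real.rpow_le_rpow hx.le h1 ht
  · rw [abs_of_nonpos ht]
    calc x ^ t = K ^ (-t) * (K * x) ^ t := by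
          rw [Real.mul_rpow hK.le hx.le, ← mul_assoc, ← Real.rpow_add hK]
          simp
      _ ≤ K ^ (-t) * y ^ t := by
          gcongr ?_ * ?_
          exact Real.rpow_le_rpow_of_nonpos hy h2 ht

lemma rpow (h : ComparableWith K x y) (t : ℝ) : ComparableWith (K ^ |t|) (x ^ t) (y ^ t) :=
  ⟨Real.rpow_pos_of_pos h.1 t, Real.rpow_pos_of_pos h.2.1 t, h.rpow_le t, h.symm.rpow_le t⟩

end ComparableWith

section SingularValues

lemma sv1_mul_sv2 {a b c : ℝ} (ha : 0 < a) (hc : 0 < c) : sv1 a b c * sv2 a b c = a * c := by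
  have hT : 0 ≤ a ^ 2 + b ^ 2 + c ^ 2 := by positivity
  have hD : 0 ≤ (a ^ 2 + b ^ 2 + c ^ 2) ^ 2 - 4 * (a * c) ^ 2 := by
    have : (a ^ 2 + b ^ 2 + c ^ 2) ^ 2 - 4 * (a * c) ^ 2 =
        ((a - c) ^ 2 + b ^ 2) * ((a + c) ^ 2 + b ^ 2) := by ring
    rw [this]
    positivity
  unfold sv1 sv2
  rw [← Real.sqrt_mul (by positivity), Real.sqrt_eq_iff_mul_self_eq_of_pos (by positivity)]
  linear_combination (1 / 4 : ℝ) * Real.sq_sqrt hD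

lemma comparableWith_sv {a b c C : ℝ} (hc : 0 < c) (hca : c ≤ a) (hb : |b| ≤ C * a) :
    ComparableWith (2 + C) (sv1 a b c) a ∧ ComparableWith (2 + C) (sv2 a b c) c := by
  have ha : 0 < a := hc.trans_le hca
  have hC : 0 ≤ C := nonneg_of_mul_nonneg_left ((abs_nonneg b).trans hb) ha
  have hprod := sv1_mul_sv2 (b := b) ha hc
  have hb2 : b ^ 2 ≤ (C * a) ^ 2 := sq_le_sq' (by linarith [neg_abs_le b])
    ((le_abs_self b).trans hb)
  have hsq : sv1 a b c ^ 2 = ((a ^ 2 + b ^ 2 + c ^ 2) +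
      √((a ^ 2 + b ^ 2 + c ^ 2) ^ 2 - 4 * (a * c) ^ 2)) / 2 := Real.sq_sqrt (by positivity)
  have hrt : √((a ^ 2 + b ^ 2 + c ^ 2) ^ 2 - 4 * (a * c) ^ 2) ≤ a ^ 2 + b ^ 2 + c ^ 2 :=
    Real.sqrt_le_iff.2 ⟨by positivity, by nlinarith [sq_nonneg (a * c)]⟩
  have h0 : 0 ≤ sv1 a b c := Real.sqrt_nonneg _
  have h0' : 0 ≤ sv2 a b c := Real.sqrt_nonneg _
  have hlow : a ≤ 2 * sv1 a b c := by
    refine (sq_le_sq₀ (by positivity) (by positivity)).1 ?_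
    nlinarith [Real.sqrt_nonneg ((a ^ 2 + b ^ 2 + c ^ 2) ^ 2 - 4 * (a * c) ^ 2), sq_nonneg b,
      sq_nonneg c]
  have hup : sv1 a b c ≤ (2 + C) * a := by
    refine (sq_le_sq₀ (by positivity) (by positivity)).1 ?_
    nlinarith [mul_nonneg hC (sq_nonneg a)]
  have hpos1 : 0 < sv1 a b c := by linarith
  have hpos2 : 0 < sv2 a b c := by
    refine pos_of_mul_pos_right ?_ h0
    rw [hprod]
    positivity
  refine ⟨⟨hpos1, ha, hup, ?_⟩, hpos2, hc, ?_, ?_⟩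
  · nlinarith
  · have : a * sv2 a b c ≤ a * (2 * c) := by nlinarith
    have := le_of_mul_le_mul_left this ha
    nlinarith
  · have : a * c ≤ a * ((2 + C) * sv2 a b c) := by nlinarith
    exact le_of_mul_le_mul_left this ha

end SingularValues

section Jacobian

variable {κ : Type*} {f : κ → ℝ → ℝ} {g : κ → ℝ × ℝ → ℝ}

lemma Sword_append (l m : List κ) (a : ℝ × ℝ) :
    Sword f g (l ++ m) a = Sword f g l (Sword f g m a) := by
  induction l with
  | nil => rfl
  | cons i l ih => simp [Sword, ih]

lemma hasFDerivAt_Smap (hf : ∀ i, Differentiable ℝ (f i)) (hg : ∀ i, Differentiable ℝ (g i))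
    (i : κ) (b : ℝ × ℝ) :
    HasFDerivAt (Smap f g i)
      ((deriv (f i) b.1 • ContinuousLinearMap.fst ℝ ℝ ℝ).prod (fderiv ℝ (g i) b)) b :=
  ((hf i b.1).hasDerivAt.comp_hasFDerivAt b hasFDerivAt_fst).prodMk (hg i b).hasFDerivAt

lemma differentiable_Sword (hf : ∀ i, Differentiable ℝ (f i)) (hg : ∀ i, Differentiable ℝ (g i))
    (l : List κ) : Differentiable ℝ (Sword f g l) := by
  induction l with
  | nil => exact differentiable_id
  | cons i l ih =>
    exact Differentiable.comp (fun b => (hasFDerivAt_Smap hf hg i b).differentiableAt) ih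

lemma fderiv_Sword_cons (hf : ∀ i, Differentiable ℝ (f i)) (hg : ∀ i, Differentiable ℝ (g i))
    (i : κ) (l : List κ) (a v : ℝ × ℝ) :
    fderiv ℝ (Sword f g (i :: l)) a v =
      (deriv (f i) (Sword f g l a).1 * (fderiv ℝ (Sword f g l) a v).1,
        fderiv ℝ (g i) (Sword f g l a) (fderiv ℝ (Sword f g l) a v)) := by
  have := (hasFDerivAt_Smap hf hg i (Sword f g l a)).comp a
    (differentiable_Sword hf hg l a).hasFDerivAt
  rw [Sword, this.fderiv]
  simp

lemma hasDerivAt_comp_left {F : ℝ × ℝ → ℝ × ℝ} (hF : Differentiable ℝ F) (a : ℝ × ℝ) :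
    HasDerivAt (fun x => F (x, a.2)) (fderiv ℝ F a (1, 0)) a.1 :=
  (hF a).hasFDerivAt.comp_hasDerivAt_of_eq a.1
    ((hasDerivAt_id a.1).prodMk (hasDerivAt_const a.1 a.2)) rfl

lemma hasDerivAt_comp_right {F : ℝ × ℝ → ℝ × ℝ} (hF : Differentiable ℝ F) (a : ℝ × ℝ) :
    HasDerivAt (fun y => F (a.1, y)) (fderiv ℝ F a (0, 1)) a.2 :=
  (hF a).hasFDerivAt.comp_hasDerivAt_of_eq a.2
    ((hasDerivAt_const a.2 a.1).prodMk (hasDerivAt_id a.2)) rfl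

lemma fxw_eq (hf : ∀ i, Differentiable ℝ (f i)) (hg : ∀ i, Differentiable ℝ (g i))
    (l : List κ) (a : ℝ × ℝ) : fxw f g l a = (fderiv ℝ (Sword f g l) a (1, 0)).1 :=
  (hasDerivAt_comp_left (differentiable_Sword hf hg l) a).hasFDerivAt.fst.hasDerivAt.deriv.trans
    (by simp)

lemma gxw_eq (hf : ∀ i, Differentiable ℝ (f i)) (hg : ∀ i, Differentiable ℝ (g i))
    (l : List κ) (a : ℝ × ℝ) : gxw f g l a = (fderiv ℝ (Sword f g l) a (1, 0)).2 :=
  (hasDerivAt_comp_left (differentiable_Sword hf hg l) a).hasFDerivAt.snd.hasDerivAt.deriv.trans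
    (by simp)

lemma gyw_eq (hf : ∀ i, Differentiable ℝ (f i)) (hg : ∀ i, Differentiable ℝ (g i))
    (l : List κ) (a : ℝ × ℝ) : gyw f g l a = (fderiv ℝ (Sword f g l) a (0, 1)).2 :=
  (hasDerivAt_comp_right (differentiable_Sword hf hg l) a).hasFDerivAt.snd.hasDerivAt.deriv.trans
    (by simp)

lemma fderiv_Sword_nil (a v : ℝ × ℝ) : fderiv ℝ (Sword f g []) a v = v := by
  simp [Sword]

lemma fderiv_Sword_vertical (hf : ∀ i, Differentiable ℝ (f i))
    (hg : ∀ i, Differentiable ℝ (g i)) (l : List κ) (a : ℝ × ℝ) :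
    (fderiv ℝ (Sword f g l) a (0, 1)).1 = 0 := by
  induction l with
  | nil => simp [fderiv_Sword_nil]
  | cons i l ih => simp [fderiv_Sword_cons hf hg, ih]

lemma fxw_singleton (hf : ∀ i, Differentiable ℝ (f i)) (hg : ∀ i, Differentiable ℝ (g i))
    (i : κ) (a : ℝ × ℝ) : fxw f g [i] a = deriv (f i) a.1 := by
  rw [fxw_eq hf hg, fderiv_Sword_cons hf hg, fderiv_Sword_nil]
  simp [Sword]

lemma gxw_singleton (hf : ∀ i, Differentiable ℝ (f i)) (hg : ∀ i, Differentiable ℝ (g i))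
    (i : κ) (a : ℝ × ℝ) : gxw f g [i] a = fderiv ℝ (g i) a (1, 0) := by
  rw [gxw_eq hf hg, fderiv_Sword_cons hf hg, fderiv_Sword_nil]
  simp [Sword]

lemma gyw_singleton (hf : ∀ i, Differentiable ℝ (f i)) (hg : ∀ i, Differentiable ℝ (g i))
    (i : κ) (a : ℝ × ℝ) : gyw f g [i] a = fderiv ℝ (g i) a (0, 1) := by
  rw [gyw_eq hf hg, fderiv_Sword_cons hf hg, fderiv_Sword_nil]
  simp [Sword]

lemma fxw_nil (a : ℝ × ℝ) : fxw f g [] a = 1 := by simp [fxw, Sword]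

lemma gxw_nil (a : ℝ × ℝ) : gxw f g [] a = 0 := by simp [gxw, Sword]

lemma gyw_nil (a : ℝ × ℝ) : gyw f g [] a = 1 := by simp [gyw, Sword]

lemma fxw_cons (hf : ∀ i, Differentiable ℝ (f i)) (hg : ∀ i, Differentiable ℝ (g i))
    (i : κ) (l : List κ) (a : ℝ × ℝ) :
    fxw f g (i :: l) a = fxw f g [i] (Sword f g l a) * fxw f g l a := by
  rw [fxw_singleton hf hg, fxw_eq hf hg, fxw_eq hf hg, fderiv_Sword_cons hf hg]

lemma gyw_cons (hf : ∀ i, Differentiable ℝ (f i)) (hg : ∀ i, Differentiable ℝ (g i))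
    (i : κ) (l : List κ) (a : ℝ × ℝ) :
    gyw f g (i :: l) a = gyw f g [i] (Sword f g l a) * gyw f g l a := by
  rw [gyw_singleton hf hg, gyw_eq hf hg, gyw_eq hf hg, fderiv_Sword_cons hf hg]
  have : fderiv ℝ (Sword f g l) a (0, 1) =
      (fderiv ℝ (Sword f g l) a (0, 1)).2 • ((0, 1) : ℝ × ℝ) := by
    ext <;> simp [fderiv_Sword_vertical hf hg]
  conv_lhs => rw [this, map_smul]
  simp [mul_comm]

lemma gxw_cons (hf : ∀ i, Differentiable ℝ (f i)) (hg : ∀ i, Differentiable ℝ (g i))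
    (i : κ) (l : List κ) (a : ℝ × ℝ) :
    gxw f g (i :: l) a = gxw f g [i] (Sword f g l a) * fxw f g l a +
      gyw f g [i] (Sword f g l a) * gxw f g l a := by
  rw [gxw_singleton hf hg, gyw_singleton hf hg, gxw_eq hf hg, gxw_eq hf hg, fxw_eq hf hg,
    fderiv_Sword_cons hf hg]
  generalize fderiv ℝ (Sword f g l) a (1, 0) = w
  have : w = w.1 • ((1, 0) : ℝ × ℝ) + w.2 • ((0, 1) : ℝ × ℝ) := by ext <;> simp
  conv_lhs => rw [this, map_add, map_smul, map_smul]
  simp [mul_comm]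

/-- A cocycle over the maps `Sword f g` is multiplicative along concatenation. -/
lemma cocycle_append {U : List κ → ℝ × ℝ → ℝ} (hnil : ∀ a, U [] a = 1)
    (hcons : ∀ i l a, U (i :: l) a = U [i] (Sword f g l a) * U l a)
    (l m : List κ) (a : ℝ × ℝ) : U (l ++ m) a = U l (Sword f g m a) * U m a := by
  induction l with
  | nil => simp [hnil]
  | cons i l ih => rw [List.cons_append, hcons, ih, hcons i l, Sword_append, mul_assoc]

end Jacobian

section Distortion

lemma zero_mem_unitSq : (0 : ℝ × ℝ) ∈ unitSq := by
  simp [unitSq, -Set.Icc_prod_Icc]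

variable {f : ι → ℝ → ℝ} {g : ι → ℝ × ℝ → ℝ} {α d : ℝ}

lemma norm_sub_le_one {a b : ℝ × ℝ} (ha : a ∈ unitSq) (hb : b ∈ unitSq) : ‖a - b‖ ≤ 1 := by
  obtain ⟨⟨h1, h2⟩, h3, h4⟩ := ha
  obtain ⟨⟨h5, h6⟩, h7, h8⟩ := hb
  rw [Prod.norm_def, max_le_iff]
  constructor <;> rw [Real.norm_eq_abs, abs_le] <;> constructor <;> simp <;> linarith

lemma IFSHyp.mapsTo_Sword (h : IFSHyp f g α d) (l : List ι) :
    Set.MapsTo (Sword f g l) unitSq unitSq := by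
  induction l with
  | nil => exact Set.mapsTo_id _
  | cons i l ih => exact fun a ha => ⟨h.maps_f i (ih ha).1, h.maps_g i (ih ha)⟩

lemma IFSHyp.exists_contraction (h : IFSHyp f g α d) :
    ∃ c : ℝ, 0 ≤ c ∧ c < 1 ∧ ∀ l : List ι, ∀ a ∈ unitSq, ∀ b ∈ unitSq,
      ‖Sword f g l a - Sword f g l b‖ ≤ c ^ l.length := by
  choose cf hf0 hf1 hf using h.contr_f
  choose cg hg0 hg1 hg using h.contr_g
  have : Nonempty (Set.Ico (0 : ℝ) 1) := ⟨⟨0, by simp⟩⟩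
  obtain ⟨⟨c, hc0, hc1⟩, hc⟩ := Finite.exists_le
    (fun i => (⟨max (cf i) (cg i), le_max_of_le_left (hf0 i), max_lt (hf1 i) (hg1 i)⟩ :
      Set.Ico (0 : ℝ) 1))
  have hc' : ∀ i, cf i ≤ c ∧ cg i ≤ c := fun i => max_le_iff.1 (Subtype.mk_le_mk.1 (hc i))
  refine ⟨c, hc0, hc1, fun l a ha b hb => ?_⟩
  induction l with
  | nil => simpa [Sword] using norm_sub_le_one ha hb
  | cons i l ih =>
    have hSa := h.mapsTo_Sword l ha
    have hSb := h.mapsTo_Sword l hb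
    rw [List.length_cons, pow_succ']
    refine le_trans ?_ (mul_le_mul_of_nonneg_left ih hc0)
    rw [Prod.norm_def]
    refine max_le ?_ ?_
    · refine (hf i _ hSa.1 _ hSb.1).trans ?_
      exact mul_le_mul (hc' i).1 (norm_fst_le (Sword f g l a - Sword f g l b))
        (abs_nonneg _) hc0
    · exact (hg i _ hSa _ hSb).trans (by gcongr; exact (hc' i).2)

/-- Bounded distortion for a positive Hölder cocycle. -/
lemma IFSHyp.exists_distortion (h : IFSHyp f g α d) {U : List ι → ℝ × ℝ → ℝ}
    (hnil : ∀ a, U [] a = 1)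
    (hcons : ∀ i l a, U (i :: l) a = U [i] (Sword f g l a) * U l a)
    (hd : ∀ i, ∀ a ∈ unitSq, d ≤ U [i] a)
    (hH : ∀ i, ∃ H : ℝ, ∀ a ∈ unitSq, ∀ b ∈ unitSq, |U [i] a - U [i] b| ≤ H * ‖a - b‖ ^ α) :
    ∃ D : ℝ, ∀ l : List ι, ∀ a ∈ unitSq, ∀ b ∈ unitSq, ComparableWith D (U l a) (U l b) := by
  obtain ⟨c, hc0, hc1, hc⟩ := h.exists_contraction
  choose H' hH' using hH
  obtain ⟨H, hHH⟩ := Finite.exists_le (fun i => |H' i|)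
  have hd0 := h.d_pos
  have hα := h.alpha_pos
  have hpos : ∀ l : List ι, ∀ a ∈ unitSq, 0 < U l a := by
    intro l a ha
    induction l with
    | nil => simp [hnil]
    | cons i l ih =>
      rw [hcons]
      exact mul_pos (hd0.trans_le (hd i _ (h.mapsTo_Sword l ha))) ih
  have hH0 : 0 ≤ H := by
    obtain ⟨i⟩ : Nonempty ι := Fintype.card_pos_iff.1 (by linarith [h.card2])
    exact (abs_nonneg _).trans (hHH i)
  set r := c ^ α with hr
  have hr0 : 0 ≤ r := Real.rpow_nonneg hc0 α
  have hr1 : r < 1 := Real.rpow_lt_one hc0 hc1 hα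
  have key : ∀ l : List ι, ∀ a ∈ unitSq, ∀ b ∈ unitSq,
      U l a ≤ Real.exp (H / d * ∑ k ∈ Finset.range l.length, r ^ k) * U l b := by
    intro l a ha b hb
    induction l with
    | nil => simp [hnil]
    | cons i l ih =>
      have hSa := h.mapsTo_Sword l ha
      have hSb := h.mapsTo_Sword l hb
      have hpow : ‖Sword f g l a - Sword f g l b‖ ^ α ≤ r ^ l.length := by
        rw [hr, ← Real.rpow_natCast, ← Real.rpow_mul hc0, mul_comm, Real.rpow_mul hc0,
          Real.rpow_natCast]
        exact Real.rpow_le_rpow (norm_nonneg _) (hc l a ha b hb) hα.le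
      have hdiff : U [i] (Sword f g l a) - U [i] (Sword f g l b) ≤ H * r ^ l.length :=
        (le_abs_self _).trans <| (hH' i _ hSa _ hSb).trans <|
          mul_le_mul ((le_abs_self _).trans (hHH i)) hpow (by positivity) hH0
      have hstep : U [i] (Sword f g l a) ≤
          Real.exp (H / d * r ^ l.length) * U [i] (Sword f g l b) := by
        have hlow := hd i _ hSb
        calc U [i] (Sword f g l a) ≤ U [i] (Sword f g l b) + H * r ^ l.length := by linarith
          _ = U [i] (Sword f g l b) + H / d * r ^ l.length * d := by field_simp
          _ ≤ U [i] (Sword f g l b) + H / d * r ^ l.length * U [i] (Sword f g l b) := by gcongr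
          _ = (H / d * r ^ l.length + 1) * U [i] (Sword f g l b) := by ring
          _ ≤ _ := by
            gcongr
            · exact hd0.le.trans hlow
            · exact Real.add_one_le_exp _
      rw [hcons, hcons i l b, List.length_cons, Finset.sum_range_succ, mul_add, Real.exp_add]
      calc _ ≤ (Real.exp (H / d * r ^ l.length) * U [i] (Sword f g l b)) *
            (Real.exp (H / d * ∑ k ∈ Finset.range l.length, r ^ k) * U l b) :=
            mul_le_mul hstep ih (hpos l a ha).le ((hpos [i] _ hSa).le.trans hstep)
        _ = _ := by ring
  have key' : ∀ l : List ι, ∀ a ∈ unitSq, ∀ b ∈ unitSq,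
      U l a ≤ Real.exp (H / d * (1 - r)⁻¹) * U l b := by
    intro l a ha b hb
    refine (key l a ha b hb).trans ?_
    gcongr
    · exact (hpos l b hb).le
    · rw [← tsum_geometric_of_lt_one hr0 hr1]
      exact (summable_geometric_of_lt_one hr0 hr1).sum_le_tsum _ fun k _ => pow_nonneg hr0 k
  exact ⟨_, fun l a ha b hb => ⟨hpos l a ha, hpos l b hb, key' l a ha b hb, key' l b hb a ha⟩⟩

lemma IFSHyp.fxw_holder (h : IFSHyp f g α d) (i : ι) : ∃ H : ℝ, ∀ a ∈ unitSq, ∀ b ∈ unitSq,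
    |fxw f g [i] a - fxw f g [i] b| ≤ H * ‖a - b‖ ^ α := by
  obtain ⟨H, hH⟩ := h.holder_f i
  refine ⟨|H|, fun a ha b hb => ?_⟩
  rw [fxw_singleton h.diff_f h.diff_g, fxw_singleton h.diff_f h.diff_g]
  refine (hH _ ha.1 _ hb.1).trans ?_
  exact mul_le_mul (le_abs_self H)
    (Real.rpow_le_rpow (abs_nonneg _) (norm_fst_le (a - b)) h.alpha_pos.le)
    (Real.rpow_nonneg (abs_nonneg _) _) (abs_nonneg H)

lemma IFSHyp.gxw_holder (h : IFSHyp f g α d) (i : ι) : ∃ H : ℝ, ∀ a ∈ unitSq, ∀ b ∈ unitSq,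
    |gxw f g [i] a - gxw f g [i] b| ≤ H * ‖a - b‖ ^ α := by
  obtain ⟨H, hH⟩ := h.holder_g i
  refine ⟨H, fun a ha b hb => ?_⟩
  rw [gxw_singleton h.diff_f h.diff_g, gxw_singleton h.diff_f h.diff_g]
  simpa [Prod.norm_def] using
    ((fderiv ℝ (g i) a - fderiv ℝ (g i) b).le_of_opNorm_le (hH a ha b hb) (1, 0))

lemma IFSHyp.gyw_holder (h : IFSHyp f g α d) (i : ι) : ∃ H : ℝ, ∀ a ∈ unitSq, ∀ b ∈ unitSq,
    |gyw f g [i] a - gyw f g [i] b| ≤ H * ‖a - b‖ ^ α := by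
  obtain ⟨H, hH⟩ := h.holder_g i
  refine ⟨H, fun a ha b hb => ?_⟩
  rw [gyw_singleton h.diff_f h.diff_g, gyw_singleton h.diff_f h.diff_g]
  simpa [Prod.norm_def] using
    ((fderiv ℝ (g i) a - fderiv ℝ (g i) b).le_of_opNorm_le (hH a ha b hb) (0, 1))

lemma exists_abs_le_of_holder {u : ℝ × ℝ → ℝ} {α : ℝ} (hα : 0 < α)
    (hu : ∃ H : ℝ, ∀ a ∈ unitSq, ∀ b ∈ unitSq, |u a - u b| ≤ H * ‖a - b‖ ^ α) :
    ∃ M : ℝ, ∀ a ∈ unitSq, |u a| ≤ M := by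
  obtain ⟨H, hH⟩ := hu
  have h0 := zero_mem_unitSq
  refine ⟨|u 0| + |H|, fun a ha => ?_⟩
  have h1 : |u a - u 0| ≤ |H| := by
    refine (hH a ha 0 h0).trans ?_
    calc H * ‖a - 0‖ ^ α ≤ |H| * 1 := mul_le_mul (le_abs_self H)
          (Real.rpow_le_one (norm_nonneg _) (norm_sub_le_one ha h0) hα.le)
          (by positivity) (abs_nonneg H)
      _ = |H| := mul_one _
  linarith [abs_sub_abs_le_abs_sub (u a) (u 0)]

lemma IFSHyp.exists_gap (h : IFSHyp f g α d) (i : ι) :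
    ∃ δ : ℝ, 0 < δ ∧ ∀ a ∈ unitSq, gyw f g [i] a + δ ≤ fxw f g [i] a := by
  obtain ⟨M, hM⟩ := exists_abs_le_of_holder h.alpha_pos (h.fxw_holder i)
  obtain ⟨N, hN⟩ := exists_abs_le_of_holder h.alpha_pos (h.gyw_holder i)
  refine ⟨_, sub_pos.2 (h.dom i), fun a ha => ?_⟩
  have h1 : gyw f g [i] a ≤ sSup (gyw f g [i] '' unitSq) :=
    le_csSup ⟨N, by rintro _ ⟨b, hb, rfl⟩; exact (abs_le.1 (hN b hb)).2⟩ ⟨a, ha, rfl⟩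
  have h2 : sInf (fxw f g [i] '' unitSq) ≤ fxw f g [i] a :=
    csInf_le ⟨-M, by rintro _ ⟨b, hb, rfl⟩; exact (abs_le.1 (hM b hb)).1⟩ ⟨a, ha, rfl⟩
  linarith

lemma IFSHyp.gyw_pos_le_fxw (h : IFSHyp f g α d) (l : List ι) {a : ℝ × ℝ} (ha : a ∈ unitSq) :
    0 < gyw f g l a ∧ gyw f g l a ≤ fxw f g l a := by
  induction l with
  | nil => simp [gyw_nil, fxw_nil]
  | cons i l ih =>
    obtain ⟨δ, hδ, hgap⟩ := h.exists_gap i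
    have hS := h.mapsTo_Sword l ha
    have hpos : 0 < gyw f g [i] (Sword f g l a) := h.d_pos.trans_le (h.dom_d i _ hS)
    have hle := hgap _ hS
    rw [gyw_cons h.diff_f h.diff_g, fxw_cons h.diff_f h.diff_g]
    exact ⟨mul_pos hpos ih.1, mul_le_mul (by linarith) ih.2 ih.1.le (by linarith)⟩

lemma IFSHyp.exists_gxw_le (h : IFSHyp f g α d) :
    ∃ C : ℝ, ∀ l : List ι, ∀ a ∈ unitSq, |gxw f g l a| ≤ C * fxw f g l a := by
  choose δ hδ hgap using h.exists_gap
  choose M hM using fun i => exists_abs_le_of_holder h.alpha_pos (h.gxw_holder i)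
  obtain ⟨C, hC⟩ := Finite.exists_le (fun i => |M i| / δ i)
  have hC0 : 0 ≤ C := by
    obtain ⟨i⟩ : Nonempty ι := Fintype.card_pos_iff.1 (by linarith [h.card2])
    exact (div_nonneg (abs_nonneg _) (hδ i).le).trans (hC i)
  refine ⟨C, fun l a ha => ?_⟩
  induction l with
  | nil => simpa [gxw_nil, fxw_nil] using hC0
  | cons i l ih =>
    have hS := h.mapsTo_Sword l ha
    have hgy : 0 < gyw f g [i] (Sword f g l a) := (h.gyw_pos_le_fxw [i] hS).1
    have hfx : 0 < fxw f g l a := (h.gyw_pos_le_fxw l ha).1.trans_le (h.gyw_pos_le_fxw l ha).2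
    have hMC : |M i| ≤ C * δ i := (div_le_iff₀ (hδ i)).1 (hC i)
    have hgx : |gxw f g [i] (Sword f g l a)| ≤ C * δ i :=
      (hM i _ hS).trans ((le_abs_self _).trans hMC)
    rw [gxw_cons h.diff_f h.diff_g, fxw_cons h.diff_f h.diff_g]
    calc _ ≤ |gxw f g [i] (Sword f g l a)| * fxw f g l a +
          gyw f g [i] (Sword f g l a) * |gxw f g l a| := by
          refine (abs_add_le _ _).trans_eq ?_
          rw [abs_mul, abs_mul, abs_of_pos hfx, abs_of_pos hgy]
      _ ≤ C * δ i * fxw f g l a + gyw f g [i] (Sword f g l a) * (C * fxw f g l a) := by gcongr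
      _ = C * ((gyw f g [i] (Sword f g l a) + δ i) * fxw f g l a) := by ring
      _ ≤ C * (fxw f g [i] (Sword f g l a) * fxw f g l a) := by
          gcongr
          exact hgap i _ hS

/-- A function comparable to a cocycle with bounded distortion is almost multiplicative. -/
lemma IFSHyp.comparableWith_append (h : IFSHyp f g α d) {U V : List ι → ℝ × ℝ → ℝ} {K D : ℝ}
    (hnil : ∀ a, U [] a = 1)
    (hcons : ∀ i l a, U (i :: l) a = U [i] (Sword f g l a) * U l a)
    (hD : ∀ l : List ι, ∀ a ∈ unitSq, ∀ b ∈ unitSq, ComparableWith D (U l a) (U l b))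
    (hV : ∀ l : List ι, ∀ a ∈ unitSq, ComparableWith K (V l a) (U l a))
    (l m : List ι) {a : ℝ × ℝ} (ha : a ∈ unitSq) :
    ComparableWith (K * (D * 1) * (K * K)) (V (l ++ m) a) (V l a * V m a) := by
  have h1 := hV (l ++ m) a ha
  rw [cocycle_append hnil hcons] at h1
  exact (h1.trans ((hD l _ (h.mapsTo_Sword m ha) a ha).mul
    (ComparableWith.refl (hV m a ha).2.1))).trans ((hV l a ha).mul (hV m a ha)).symm

end Distortion

theorem psiSV_almost_multiplicative {ι : Type*} [Fintype ι]
    (f : ι → ℝ → ℝ) (g : ι → ℝ × ℝ → ℝ) (α d : ℝ) (h : IFSHyp f g α d)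
    (p : ι → ℝ) (hp : ProbVec p) (s q βq : ℝ) (hq : 0 ≤ q) :
    ∃ K₁ K₂ : ℝ, 0 < K₁ ∧ K₁ ≤ K₂ ∧
      ∀ l m : List ι, l ≠ [] → m ≠ [] → ∀ a ∈ unitSq,
        K₁ * (psiSV f g p s q βq a l * psiSV f g p s q βq a m) ≤ psiSV f g p s q βq a (l ++ m) ∧
        psiSV f g p s q βq a (l ++ m) ≤ K₂ * (psiSV f g p s q βq a l * psiSV f g p s q βq a m) := by
  obtain ⟨C, hC⟩ := h.exists_gxw_le
  have hsv := fun (l : List ι) (a : ℝ × ℝ) (ha : a ∈ unitSq) =>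
    comparableWith_sv (h.gyw_pos_le_fxw l ha).1 (h.gyw_pos_le_fxw l ha).2 (hC l a ha)
  have hfcons := fxw_cons (f := f) (g := g) h.diff_f h.diff_g
  have hgcons := gyw_cons (f := f) (g := g) h.diff_f h.diff_g
  obtain ⟨D, hD⟩ := h.exists_distortion fxw_nil hfcons
    (fun i a ha => (h.dom_d i a ha).trans (h.gyw_pos_le_fxw [i] ha).2) h.fxw_holder
  obtain ⟨E, hE⟩ := h.exists_distortion gyw_nil hgcons h.dom_d h.gyw_holder
  have hone := fun (l m : List ι) (a : ℝ × ℝ) (ha : a ∈ unitSq) =>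
    (h.comparableWith_append (V := alphaOne f g) fxw_nil hfcons hD
      (fun l a ha => (hsv l a ha).1) l m ha).rpow βq
  have htwo := fun (l m : List ι) (a : ℝ × ℝ) (ha : a ∈ unitSq) =>
    (h.comparableWith_append (V := alphaTwo f g) gyw_nil hgcons hE
      (fun l a ha => (hsv l a ha).2) l m ha).rpow (s - βq)
  have hp0 : ∀ l : List ι, 0 < pword p l := fun l =>
    List.prod_pos (by simpa using fun i _ => (hp.1 i).1)
  have hpsi : ∃ K : ℝ, ∀ l m : List ι, ∀ a ∈ unitSq, ComparableWith K
      (psiSV f g p s q βq a (l ++ m)) (psiSV f g p s q βq a l * psiSV f g p s q βq a m) := by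
    have hmul := fun l m a ha => ((ComparableWith.refl
      (Real.rpow_pos_of_pos (hp0 (l ++ m)) q)).mul (hone l m a ha)).mul (htwo l m a ha)
    refine ⟨_, fun l m a ha => Eq.mp (congrArg _ ?_) (hmul l m a ha)⟩
    have hl := hsv l a ha
    have hm := hsv m a ha
    have e1 : (alphaOne f g l a * alphaOne f g m a) ^ βq =
        alphaOne f g l a ^ βq * alphaOne f g m a ^ βq := Real.mul_rpow hl.1.1.le hm.1.1.le
    have e2 : (alphaTwo f g l a * alphaTwo f g m a) ^ (s - βq) =
        alphaTwo f g l a ^ (s - βq) * alphaTwo f g m a ^ (s - βq) :=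
      Real.mul_rpow hl.2.1.le hm.2.1.le
    have e3 : pword p (l ++ m) ^ q = pword p l ^ q * pword p m ^ q := by
      rw [← Real.mul_rpow (hp0 l).le (hp0 m).le]
      simp [pword]
    rw [psiSV, psiSV, e1, e2, e3]
    ring
  obtain ⟨K, hK⟩ := hpsi
  have hK1 : 1 ≤ K := (hK [] [] 0 zero_mem_unitSq).one_le
  have hK0 : 0 < K := one_pos.trans_le hK1
  refine ⟨K⁻¹, K, inv_pos.2 hK0, (inv_le_one_of_one_le₀ hK1).trans hK1, fun l m _ _ a ha => ?_⟩
  obtain ⟨-, -, h1, h2⟩ := hK l m a ha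
  exact ⟨(inv_mul_le_iff₀ hK0).2 h2, h1⟩

end
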